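/- arXiv:2208.01365 — 3 statements merged into one kernel-verified Lean document; each statement's English description precedes it below -/
import Mathlib

section
/- Let (A^{(t)}, t ∈ [T]) follow the lazy IER process on [n] with mean matrix P = ((p_ij)) and laziness parameter α ∈ (0,1). Let ℓ_i = Σ_{j∈[n]} a_ij be the aggregated degree of vertex i, where a_ij = Σ_{t=1}^T A^{(t)}_ij, and let ℓ̄_i = E(ℓ_i). There is a constant κ = κ(α) such that, if T·d_min > C(α)(log n)^3 for a sufficiently large constant C(α) and n is sufficiently large, then for every i ∈ [n] and every δ ∈ (n^{-c}, 1/2): P( |√(ℓ_i/ℓ̄_i) − 1| > κ √( log(n/δ) / (T d_min) ) ) ≤ δ/(2n). -/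
open MeasureTheory ProbabilityTheory Finset Real

noncomputable section

/-- Value of the Bernoulli(p) pmf at `b`. -/
def bernProb (p : ℝ) (b : Bool) : ℝ := if b then p else 1 - p

/-- One-step transition probability of a lazy Bernoulli edge process:
with probability `α` keep the previous state, with probability `1 - α`
resample from Bernoulli(p). -/
def lazyStep (p α : ℝ) (prev next : Bool) : ℝ :=
  (if next = prev then α else 0) + (1 - α) * bernProb p next

/-- Probability of observing the trajectory `m` (at times `1, …, T`) under the
lazy IER process with mean matrix `P` and laziness parameter `α`:
edges (pairs `i ≤ j`) evolve independently, each as a lazy Bernoulli chain. -/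
def lazyTrajProb (n T : ℕ) (P : Matrix (Fin n) (Fin n) ℝ) (α : ℝ)
    (m : ℕ → Fin n → Fin n → Bool) : ℝ :=
  ∏ ij ∈ Finset.univ.filter (fun ij : Fin n × Fin n => ij.1 ≤ ij.2),
    (bernProb (P ij.1 ij.2) (m 1 ij.1 ij.2) *
      ∏ t ∈ Finset.Icc 2 T, lazyStep (P ij.1 ij.2) α (m (t-1) ij.1 ij.2) (m t ij.1 ij.2))

/-- `A` (whose relevant time indices are `1, …, T`) is a lazy inhomogeneous
Erdős–Rényi process on the probability space `(Ω, μ)` with symmetric mean matrix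
`P ∈ [0,1]^{n×n}` and laziness parameter `α ∈ (0,1)`. -/
structure IsLazyIER {Ω : Type} [MeasurableSpace Ω] (μ : Measure Ω)
    (n T : ℕ) (P : Matrix (Fin n) (Fin n) ℝ) (α : ℝ)
    (A : ℕ → Ω → Fin n → Fin n → Bool) : Prop where
  prob : IsProbabilityMeasure μ
  two_le_T : 2 ≤ T
  alpha_mem : α ∈ Set.Ioo (0 : ℝ) 1
  P_symm : ∀ i j, P i j = P j i
  P_mem : ∀ i j, P i j ∈ Set.Icc (0 : ℝ) 1
  A_symm : ∀ t ω i j, A t ω i j = A t ω j i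
  meas : ∀ t, Measurable (A t)
  law : ∀ m : ℕ → Fin n → Fin n → Bool, (∀ t i j, m t i j = m t j i) →
    (μ {ω | ∀ t ∈ Finset.Icc 1 T, A t ω = m t}).toReal = lazyTrajProb n T P α m

/-- Entry `(i,j)` of the aggregated adjacency matrix `A = Σ_{t=1}^T A^{(t)}`. -/
def aggE {Ω : Type} (n T : ℕ) (A : ℕ → Ω → Fin n → Fin n → Bool)
    (ω : Ω) (i j : Fin n) : ℝ :=
  ∑ t ∈ Finset.Icc 1 T, if A t ω i j then (1 : ℝ) else 0

/-- The aggregated adjacency matrix as a random matrix. -/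
def aggMatrix {Ω : Type} (n T : ℕ) (A : ℕ → Ω → Fin n → Fin n → Bool)
    (ω : Ω) : Matrix (Fin n) (Fin n) ℝ :=
  Matrix.of fun i j => aggE n T A ω i j

/-- Entrywise expectation `Ā = E A` of the aggregated adjacency matrix. -/
def aggMean {Ω : Type} [MeasurableSpace Ω] (μ : Measure Ω)
    (n T : ℕ) (A : ℕ → Ω → Fin n → Fin n → Bool) : Matrix (Fin n) (Fin n) ℝ :=
  Matrix.of fun i j => ∫ ω, aggE n T A ω i j ∂μ

/-- The operator (spectral) norm of a real matrix, i.e. the norm of the induced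
linear map between Euclidean spaces. -/
def opNorm {k l : ℕ} (M : Matrix (Fin k) (Fin l) ℝ) : ℝ :=
  ‖LinearMap.toContinuousLinearMap (Matrix.toEuclideanLin M)‖

/-- Maximum expected degree `d_max = max_i Σ_j p_ij`. -/
def dMax {n : ℕ} (P : Matrix (Fin n) (Fin n) ℝ) : ℝ := ⨆ i, ∑ j, P i j

/-- Minimum expected degree `d_min = min_i Σ_j p_ij`. -/
def dMin {n : ℕ} (P : Matrix (Fin n) (Fin n) ℝ) : ℝ := ⨅ i, ∑ j, P i j

/-- Aggregated degree `ℓ_i = Σ_j a_ij` of vertex `i`. -/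
def aggDeg {Ω : Type} (n T : ℕ) (A : ℕ → Ω → Fin n → Fin n → Bool)
    (ω : Ω) (i : Fin n) : ℝ :=
  ∑ j, aggE n T A ω i j

/-- Expected aggregated degree `ℓ̄_i = E ℓ_i`. -/
def meanDeg {Ω : Type} [MeasurableSpace Ω] (μ : Measure Ω)
    (n T : ℕ) (A : ℕ → Ω → Fin n → Fin n → Bool) (i : Fin n) : ℝ :=
  ∑ j, ∫ ω, aggE n T A ω i j ∂μ

/-- Probability that a single lazy Bernoulli chain follows `y` at times `1, …, T`. -/
def chainProb (p α : ℝ) (T : ℕ) (y : ℕ → Bool) : ℝ :=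
  bernProb p (y 1) * ∏ t ∈ Finset.Icc 2 T, lazyStep p α (y (t - 1)) (y t)

lemma bernProb_nonneg {p : ℝ} (hp : p ∈ Set.Icc (0 : ℝ) 1) (b : Bool) : 0 ≤ bernProb p b := by
  obtain ⟨h0, h1⟩ := hp
  cases b <;> simp [bernProb] <;> linarith

lemma lazyStep_nonneg {p α : ℝ} (hp : p ∈ Set.Icc (0 : ℝ) 1) (hα : α ∈ Set.Ioo (0 : ℝ) 1)
    (a b : Bool) : 0 ≤ lazyStep p α a b := by
  have h := mul_nonneg (sub_nonneg.2 hα.2.le) (bernProb_nonneg hp b)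
  have h' : 0 ≤ (if b = a then α else 0) := by split_ifs; exacts [hα.1.le, le_rfl]
  exact add_nonneg h' h

lemma chainProb_nonneg {p α : ℝ} (hp : p ∈ Set.Icc (0 : ℝ) 1) (hα : α ∈ Set.Ioo (0 : ℝ) 1)
    (T : ℕ) (y : ℕ → Bool) : 0 ≤ chainProb p α T y :=
  mul_nonneg (bernProb_nonneg hp _) (Finset.prod_nonneg fun _ _ => lazyStep_nonneg hp hα _ _)

lemma chainProb_congr {p α : ℝ} {T : ℕ} (hT : 1 ≤ T) {y z : ℕ → Bool}
    (h : ∀ t ∈ Finset.Icc 1 T, y t = z t) : chainProb p α T y = chainProb p α T z := by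
  unfold chainProb
  rw [h 1 (by simp; omega)]
  congr 1
  refine Finset.prod_congr rfl fun t ht => ?_
  rw [Finset.mem_Icc] at ht
  rw [h t (by simp; omega), h (t - 1) (by simp; omega)]

lemma chainProb_succ {p α : ℝ} {T : ℕ} (hT : 1 ≤ T) (y : ℕ → Bool) :
    chainProb p α (T + 1) y = chainProb p α T y * lazyStep p α (y T) (y (T + 1)) := by
  unfold chainProb
  rw [Finset.prod_Icc_succ_top (by omega), mul_assoc]
  simp

/-- The conditional moment generating function of one step of the chain. -/
lemma lazyStep_mgf_le (p α θ : ℝ) (a : Bool) :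
    lazyStep p α a false + lazyStep p α a true * exp θ ≤
      exp (((if a then α else 0) + (1 - α) * p) * (exp θ - 1)) := by
  refine le_trans (le_of_eq ?_) (add_one_le_exp _)
  cases a <;> simp [lazyStep, bernProb] <;> ring

/-- Moment generating function of the occupation time of a lazy Bernoulli chain, with the last
time carrying an additional weight `η`. -/
lemma chain_mgf_le_aux {p α l R : ℝ} (hp : p ∈ Set.Icc (0 : ℝ) 1) (hα : α ∈ Set.Ioo (0 : ℝ) 1)
    (hl : |l| ≤ (1 - α) * R / 2) (hR : R ≤ (1 - α) / 2) (T : ℕ) (hT : 1 ≤ T) :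
    ∀ η : ℝ, |l + η| ≤ R →
      ∑ s ∈ (Finset.Icc 1 T).powerset, chainProb p α T (fun t => decide (t ∈ s)) *
        exp (l * #s + if T ∈ s then η else 0) ≤ exp (p * (η + T * (l + R ^ 2))) := by
  have hα0 := hα.1
  have hα1 := hα.2
  have hquad : ∀ θ : ℝ, |θ| ≤ R → |exp θ - 1 - θ| ≤ R ^ 2 := fun θ hθ =>
    (abs_exp_sub_one_sub_id_le (by linarith)).trans (sq_le_sq' (abs_le.1 hθ).1 (abs_le.1 hθ).2)
  induction T, hT using Nat.le_induction with
  | base =>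
    intro η hη
    have h1 : (Finset.Icc 1 1 : Finset ℕ) = insert 1 ∅ := by simp
    rw [h1, Finset.sum_powerset_insert (by simp)]
    simp only [Finset.powerset_empty, Finset.sum_singleton, chainProb]
    simp only [bernProb]
    simp
    have h2 := (abs_le.1 (hquad _ hη)).2
    have h3 := add_one_le_exp (p * (exp (l + η) - 1))
    have h4 : p * (exp (l + η) - 1) ≤ p * (η + (l + R ^ 2)) :=
      mul_le_mul_of_nonneg_left (by linarith) hp.1
    have h5 := exp_le_exp.2 h4
    linarith
  | succ T hT ih =>
    intro η hη
    have h1 : Finset.Icc 1 (T + 1) = insert (T + 1) (Finset.Icc 1 T) := by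
      ext t; simp; omega
    rw [h1, Finset.sum_powerset_insert (by simp), ← Finset.sum_add_distrib]
    have hq := abs_le.1 (hquad _ hη)
    have hη' := abs_le.1 hη
    have hl' := abs_le.1 hl
    set ψ := exp (l + η) - 1 with hψ
    have hR0 : 0 ≤ R := (abs_nonneg _).trans hη
    have hRR : R ^ 2 ≤ R * (1 - α) / 2 := by nlinarith
    have key : |l + α * ψ| ≤ R := by
      rw [abs_le]; constructor <;> nlinarith [sq_nonneg R]
    calc _ ≤ ∑ s ∈ (Finset.Icc 1 T).powerset, exp ((1 - α) * p * ψ) *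
          (chainProb p α T (fun t => decide (t ∈ s)) *
            exp (l * #s + if T ∈ s then α * ψ else 0)) := by
          refine Finset.sum_le_sum fun s hs => ?_
          rw [Finset.mem_powerset] at hs
          have hTs : T + 1 ∉ s := fun h => by simpa using hs h
          rw [chainProb_succ hT, chainProb_succ hT]
          have hc : chainProb p α T (fun t => decide (t ∈ insert (T + 1) s)) =
              chainProb p α T (fun t => decide (t ∈ s)) :=
            chainProb_congr hT fun t ht => by
              rw [Finset.mem_Icc] at ht
              have : t ≠ T + 1 := by omega
              simp [this]
          rw [hc, Finset.card_insert_of_notMem hTs]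
          have hm := lazyStep_mgf_le p α (l + η) (decide (T ∈ s))
          have hn := chainProb_nonneg hp hα T (fun t => decide (t ∈ s))
          have hfin := mul_le_mul_of_nonneg_left hm (mul_nonneg hn (exp_pos (l * #s)).le)
          refine le_trans (le_of_eq ?_) (hfin.trans (le_of_eq ?_))
          · have e1 : exp (l * ((#s + 1 : ℕ) : ℝ) + η) = exp (l * #s) * exp (l + η) := by
              rw [← exp_add]; push_cast; ring_nf
            have hT1 : (T = T + 1) = False := by simp
            simp only [hTs, hT1, Finset.mem_insert, false_or, true_or, decide_true, decide_false, if_true,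
              if_false, add_zero, e1]
            ring
          · rw [← hψ]
            rw [mul_assoc, ← exp_add, mul_left_comm, ← exp_add]
            congr 2
            by_cases hs' : T ∈ s <;> simp [hs'] <;> ring
      _ = exp ((1 - α) * p * ψ) * ∑ s ∈ (Finset.Icc 1 T).powerset,
          (chainProb p α T (fun t => decide (t ∈ s)) *
            exp (l * #s + if T ∈ s then α * ψ else 0)) := by rw [Finset.mul_sum]
      _ ≤ exp ((1 - α) * p * ψ) * exp (p * (α * ψ + T * (l + R ^ 2))) :=
          mul_le_mul_of_nonneg_left (ih _ key) (exp_pos _).le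
      _ ≤ _ := by
          rw [← exp_add, exp_le_exp]
          push_cast
          have : p * ψ ≤ p * (l + η + R ^ 2) := mul_le_mul_of_nonneg_left (by linarith) hp.1
          linarith

/-- Moment generating function bound for the occupation time of a lazy Bernoulli chain. -/
lemma chain_mgf_le {p α l : ℝ} (hp : p ∈ Set.Icc (0 : ℝ) 1) (hα : α ∈ Set.Ioo (0 : ℝ) 1)
    (hl : |l| ≤ (1 - α) ^ 2 / 4) {T : ℕ} (hT : 1 ≤ T) :
    ∑ s ∈ (Finset.Icc 1 T).powerset, chainProb p α T (fun t => decide (t ∈ s)) * exp (l * #s) ≤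
      exp (p * (T * (l + 4 / (1 - α) ^ 2 * l ^ 2))) := by
  have hα' : 0 < 1 - α := sub_pos.2 hα.2
  have h := chain_mgf_le_aux (R := 2 * |l| / (1 - α)) hp hα (by field_simp; rfl)
    (by rw [div_le_iff₀ hα']; nlinarith) T hT 0 (by
      rw [add_zero, le_div_iff₀ hα']; nlinarith [abs_nonneg l, hα.1])
  have e : (2 * |l| / (1 - α)) ^ 2 = 4 / (1 - α) ^ 2 * l ^ 2 := by
    rw [div_pow, mul_pow, sq_abs]; ring
  simpa [e] using h

/-- The pairs `i ≤ j` indexing the independent edges. -/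
abbrev EdgeIdx (n : ℕ) : Type := {e : Fin n × Fin n // e.1 ≤ e.2}

/-- The edge joining `i` and `j`. -/
def edgeIdx {n : ℕ} (i j : Fin n) : EdgeIdx n := ⟨(min i j, max i j), min_le_max⟩

lemma edgeIdx_injective {n : ℕ} (i : Fin n) : Function.Injective (edgeIdx i) := by
  intro j k h
  simp only [edgeIdx, Subtype.mk.injEq, Prod.mk.injEq] at h
  grind

lemma edgeIdx_comm {n : ℕ} (i j : Fin n) : edgeIdx i j = edgeIdx j i :=
  Subtype.ext (by simp only [edgeIdx, min_comm i j, max_comm i j])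

lemma apply_edgeIdx {n : ℕ} {β : Type*} {f : Fin n → Fin n → β} (hf : ∀ i j, f i j = f j i)
    (i j : Fin n) : f (edgeIdx i j).1.1 (edgeIdx i j).1.2 = f i j := by
  rcases le_total i j with h | h
  · simp [edgeIdx, h]
  · simp [edgeIdx, h, hf j i]

/-- The times in `1, …, T` at which each edge is present. -/
def edgeTimes {Ω : Type} (n T : ℕ) (A : ℕ → Ω → Fin n → Fin n → Bool) (ω : Ω)
    (e : EdgeIdx n) : Finset ℕ :=
  (Finset.Icc 1 T).filter fun t => A t ω e.1.1 e.1.2 = true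

lemma aggE_eq_card {Ω : Type} {n T : ℕ} {A : ℕ → Ω → Fin n → Fin n → Bool}
    (hA : ∀ t ω i j, A t ω i j = A t ω j i) (ω : Ω) (i j : Fin n) :
    aggE n T A ω i j = #(edgeTimes n T A ω (edgeIdx i j)) := by
  simp only [aggE, edgeTimes, apply_edgeIdx (hA _ ω)]
  rw [Finset.sum_boole]

lemma comp_edgeTimes_eq_sum_indicator {Ω : Type} {n T : ℕ}
    {A : ℕ → Ω → Fin n → Fin n → Bool} (g : (EdgeIdx n → Finset ℕ) → ℝ) :
    (fun ω => g (edgeTimes n T A ω)) = fun ω =>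
      ∑ q ∈ Fintype.piFinset fun _ : EdgeIdx n => (Finset.Icc 1 T).powerset,
        {ω | edgeTimes n T A ω = q}.indicator (fun _ => g q) ω := by
  ext ω
  rw [Finset.sum_eq_single (edgeTimes n T A ω)]
  · simp
  · intro q _ hq
    simp [Ne.symm hq]
  · intro hω
    exact absurd (Fintype.mem_piFinset.2 fun e =>
      Finset.mem_powerset.2 (Finset.filter_subset _ _)) hω

namespace IsLazyIER

variable {Ω : Type} [MeasurableSpace Ω] {μ : Measure Ω} {n T : ℕ}
  {P : Matrix (Fin n) (Fin n) ℝ} {α : ℝ} {A : ℕ → Ω → Fin n → Fin n → Bool}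

lemma edgeTimes_eq_iff (h : IsLazyIER μ n T P α A) {q : EdgeIdx n → Finset ℕ}
    (hq : q ∈ Fintype.piFinset fun _ : EdgeIdx n => (Finset.Icc 1 T).powerset) (ω : Ω) :
    edgeTimes n T A ω = q ↔
      ∀ t ∈ Finset.Icc 1 T, A t ω = fun i j => decide (t ∈ q (edgeIdx i j)) := by
  constructor
  · rintro rfl t ht
    ext i j
    simp [edgeTimes, apply_edgeIdx (h.A_symm t ω), Finset.mem_Icc.1 ht]
  · intro hA
    ext e t
    have hsub := Finset.mem_powerset.1 (Fintype.mem_piFinset.1 hq e)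
    have he : edgeIdx e.1.1 e.1.2 = e := by
      apply Subtype.ext
      simp [edgeIdx, e.2]
    by_cases ht : t ∈ Finset.Icc 1 T
    · simp [edgeTimes, hA t ht, he, Finset.mem_Icc.1 ht]
    · have : t ∉ q e := fun h' => ht (hsub h')
      simp [edgeTimes, this, Finset.mem_Icc.not.1 ht]

lemma measurableSet_edgeTimes_eq (h : IsLazyIER μ n T P α A) {q : EdgeIdx n → Finset ℕ}
    (hq : q ∈ Fintype.piFinset fun _ : EdgeIdx n => (Finset.Icc 1 T).powerset) :
    MeasurableSet {ω | edgeTimes n T A ω = q} := by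
  simp_rw [h.edgeTimes_eq_iff hq, Set.ofPred_forall]
  exact MeasurableSet.iInter fun t => MeasurableSet.iInter fun _ =>
    h.meas t (measurableSet_singleton _)

lemma measureReal_edgeTimes_eq (h : IsLazyIER μ n T P α A) {q : EdgeIdx n → Finset ℕ}
    (hq : q ∈ Fintype.piFinset fun _ : EdgeIdx n => (Finset.Icc 1 T).powerset) :
    μ.real {ω | edgeTimes n T A ω = q} =
      ∏ e : EdgeIdx n, chainProb (P e.1.1 e.1.2) α T (fun t => decide (t ∈ q e)) := by
  simp_rw [h.edgeTimes_eq_iff hq]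
  have hlaw := h.law (fun t i j => decide (t ∈ q (edgeIdx i j)))
    (fun t i j => by rw [edgeIdx_comm])
  rw [Measure.real, hlaw, lazyTrajProb,
    Finset.prod_subtype (p := fun e : Fin n × Fin n => e.1 ≤ e.2) _ (by simp)]
  refine Finset.prod_congr rfl fun e _ => ?_
  have he : edgeIdx e.1.1 e.1.2 = e := by
    apply Subtype.ext
    simp [edgeIdx, e.2]
  simp [chainProb, he]

lemma integrable_comp_edgeTimes (h : IsLazyIER μ n T P α A)
    (g : (EdgeIdx n → Finset ℕ) → ℝ) : Integrable (fun ω => g (edgeTimes n T A ω)) μ := by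
  have := h.prob
  rw [comp_edgeTimes_eq_sum_indicator]
  exact integrable_finsetSum _ fun q hq =>
    (integrable_const _).indicator (h.measurableSet_edgeTimes_eq hq)

lemma integral_comp_edgeTimes (h : IsLazyIER μ n T P α A)
    (g : (EdgeIdx n → Finset ℕ) → ℝ) :
    ∫ ω, g (edgeTimes n T A ω) ∂μ =
      ∑ q ∈ Fintype.piFinset fun _ : EdgeIdx n => (Finset.Icc 1 T).powerset,
        (∏ e : EdgeIdx n, chainProb (P e.1.1 e.1.2) α T (fun t => decide (t ∈ q e))) * g q := by
  have := h.prob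
  rw [comp_edgeTimes_eq_sum_indicator, integral_finsetSum _ fun q hq =>
    (integrable_const _).indicator (h.measurableSet_edgeTimes_eq hq)]
  refine Finset.sum_congr rfl fun q hq => ?_
  rw [integral_indicator_const _ (h.measurableSet_edgeTimes_eq hq),
    h.measureReal_edgeTimes_eq hq, smul_eq_mul]

lemma integrable_exp_aggDeg (h : IsLazyIER μ n T P α A) (i : Fin n) (l : ℝ) :
    Integrable (fun ω => exp (l * aggDeg n T A ω i)) μ := by
  simp only [aggDeg, aggE_eq_card h.A_symm]
  exact h.integrable_comp_edgeTimes fun q => exp (l * ∑ j, (#(q (edgeIdx i j)) : ℝ))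

lemma integrable_aggE (h : IsLazyIER μ n T P α A) (i j : Fin n) :
    Integrable (fun ω => aggE n T A ω i j) μ := by
  simp only [aggE_eq_card h.A_symm]
  exact h.integrable_comp_edgeTimes fun q => (#(q (edgeIdx i j)) : ℝ)

lemma mgf_aggDeg_le (h : IsLazyIER μ n T P α A) (i : Fin n) {l : ℝ}
    (hl : |l| ≤ (1 - α) ^ 2 / 4) :
    mgf (fun ω => aggDeg n T A ω i) μ l ≤
      exp ((T * ∑ j, P i j) * (l + 4 / (1 - α) ^ 2 * l ^ 2)) := by
  have hT : 1 ≤ T := one_le_two.trans h.two_le_T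
  let w : EdgeIdx n → ℝ := fun e => if e ∈ Finset.univ.image (edgeIdx i) then l else 0
  have hw : ∀ f : EdgeIdx n → ℝ, ∑ e, w e * f e = ∑ j, l * f (edgeIdx i j) := fun f => by
    simp only [w, ite_mul, zero_mul]
    rw [Finset.sum_ite_mem, Finset.univ_inter,
      Finset.sum_image fun _ _ _ _ hjk => edgeIdx_injective i hjk]
  simp only [mgf, aggDeg, aggE_eq_card h.A_symm]
  rw [h.integral_comp_edgeTimes fun q => exp (l * ∑ j, (#(q (edgeIdx i j)) : ℝ))]
  have hprod : ∀ q : EdgeIdx n → Finset ℕ,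
      exp (l * ∑ j, (#(q (edgeIdx i j)) : ℝ)) = ∏ e, exp (w e * #(q e)) := fun q => by
    rw [← exp_sum, hw fun e => (#(q e) : ℝ), Finset.mul_sum]
  simp_rw [hprod, ← Finset.prod_mul_distrib]
  rw [← Finset.prod_univ_sum (fun _ : EdgeIdx n => (Finset.Icc 1 T).powerset) fun e s =>
    chainProb (P e.1.1 e.1.2) α T (fun t => decide (t ∈ s)) * exp (w e * #s)]
  have hwl : ∀ e, |w e| ≤ (1 - α) ^ 2 / 4 := fun e => by
    simp only [w]
    split_ifs
    · exact hl
    · rw [abs_zero]; positivity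
  have hle : ∏ e : EdgeIdx n, ∑ s ∈ (Finset.Icc 1 T).powerset,
        chainProb (P e.1.1 e.1.2) α T (fun t => decide (t ∈ s)) * exp (w e * #s) ≤
      ∏ e : EdgeIdx n, exp (P e.1.1 e.1.2 * (T * (w e + 4 / (1 - α) ^ 2 * w e ^ 2))) := by
    apply Finset.prod_le_prod
    · exact fun e _ => Finset.sum_nonneg fun s _ =>
        mul_nonneg (chainProb_nonneg (h.P_mem _ _) h.alpha_mem _ _) (exp_pos _).le
    · exact fun e _ => chain_mgf_le (h.P_mem _ _) h.alpha_mem (hwl e) hT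
  refine hle.trans (le_of_eq ?_)
  rw [← exp_sum]
  congr 1
  calc _ = ∑ e : EdgeIdx n,
        w e * (P e.1.1 e.1.2 * T * (1 + 4 / (1 - α) ^ 2 * w e)) :=
        Finset.sum_congr rfl fun e _ => by ring
    _ = ∑ j, l * (P i j * T * (1 + 4 / (1 - α) ^ 2 * l)) := by
        rw [hw fun e => P e.1.1 e.1.2 * T * (1 + 4 / (1 - α) ^ 2 * w e)]
        refine Finset.sum_congr rfl fun j _ => ?_
        rw [apply_edgeIdx h.P_symm]
        simp [w]
    _ = _ := by
        rw [Finset.mul_sum, Finset.sum_mul]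
        exact Finset.sum_congr rfl fun j _ => by ring

/-- The expected aggregated degree is `T` times the expected degree. -/
lemma meanDeg_eq (h : IsLazyIER μ n T P α A) (i : Fin n) :
    meanDeg μ n T A i = T * ∑ j, P i j := by
  have := h.prob
  have hα : 0 < 1 - α := sub_pos.2 h.alpha_mem.2
  set m := (T * ∑ j, P i j : ℝ)
  set K := 4 / (1 - α) ^ 2
  have hE : meanDeg μ n T A i = ∫ ω, aggDeg n T A ω i ∂μ :=
    (integral_finsetSum _ fun j _ => h.integrable_aggE i j).symm
  rw [hE]
  set E := ∫ ω, aggDeg n T A ω i ∂μ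
  have hint : Integrable (fun ω => aggDeg n T A ω i) μ :=
    integrable_finsetSum _ fun j _ => h.integrable_aggE i j
  have hmin : IsLocalMin (fun l : ℝ => exp (m * (l + K * l ^ 2)) - (1 + l * E)) 0 := by
    have hnhds : Metric.closedBall (0 : ℝ) ((1 - α) ^ 2 / 4) ∈ nhds (0 : ℝ) :=
      Metric.closedBall_mem_nhds _ (by positivity)
    filter_upwards [hnhds] with l hl
    have hl' : |l| ≤ (1 - α) ^ 2 / 4 := by simpa using hl
    have h1 := h.mgf_aggDeg_le i hl'
    have h2 : 1 + l * E ≤ mgf (fun ω => aggDeg n T A ω i) μ l := by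
      have : 1 + l * E = ∫ ω, (l * aggDeg n T A ω i + 1) ∂μ := by
        rw [integral_add (hint.const_mul l) (integrable_const _), integral_const_mul]
        simp [E]
        ring
      rw [this]
      exact integral_mono ((hint.const_mul l).add (integrable_const _))
        (h.integrable_exp_aggDeg i l) fun ω => add_one_le_exp _
    have h0 : exp (m * (0 + K * 0 ^ 2)) - (1 + 0 * E) = 0 := by simp
    rw [h0]
    linarith
  have hd : HasDerivAt (fun l : ℝ => exp (m * (l + K * l ^ 2)) - (1 + l * E)) (m - E) 0 := by
    have h1 := ((((hasDerivAt_id (0 : ℝ)).add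
      (((hasDerivAt_id (0 : ℝ)).pow 2).const_mul K)).const_mul m).exp).sub
      (((hasDerivAt_id (0 : ℝ)).mul_const E).const_add 1)
    refine h1.congr_deriv ?_
    simp
  linarith [hmin.hasDerivAt_eq_zero hd]

/-- Two-sided Chernoff bound for the aggregated degree. -/
lemma measureReal_aggDeg_deviation_le (h : IsLazyIER μ n T P α A) (i : Fin n) {m x : ℝ}
    (hm : m = T * ∑ j, P i j) (hx0 : 0 ≤ x) (hx : x ≤ 2) :
    μ.real {ω | m * x ≤ |aggDeg n T A ω i - m|} ≤
      2 * exp (-(m * x ^ 2 * (1 - α) ^ 2 / 16)) := by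
  have := h.prob
  have hα : 0 < 1 - α := sub_pos.2 h.alpha_mem.2
  set l := x * (1 - α) ^ 2 / 8 with hl
  have hl0 : 0 ≤ l := by positivity
  have hl1 : l ≤ (1 - α) ^ 2 / 4 := by nlinarith [sq_nonneg (1 - α)]
  have hK : 4 / (1 - α) ^ 2 * l ^ 2 = x * l / 2 := by rw [hl]; field_simp; ring
  have hup := measure_ge_le_exp_mul_mgf (m + m * x) hl0 (h.integrable_exp_aggDeg i l)
  have hlo := measure_le_le_exp_mul_mgf (m - m * x) (neg_nonpos.2 hl0)
    (h.integrable_exp_aggDeg i (-l))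
  have hup' := h.mgf_aggDeg_le i (l := l) (by rwa [abs_of_nonneg hl0])
  have hlo' := h.mgf_aggDeg_le i (l := -l) (by rwa [abs_neg, abs_of_nonneg hl0])
  rw [← hm, hK] at hup'
  rw [← hm, neg_sq, hK] at hlo'
  have e : ∀ a : ℝ, a = -(m * (x * l / 2)) → exp a = exp (-(m * x ^ 2 * (1 - α) ^ 2 / 16)) :=
    fun a ha => by rw [ha, hl]; ring_nf
  have h1 := hup.trans (mul_le_mul_of_nonneg_left hup' (exp_pos _).le)
  have h2 := hlo.trans (mul_le_mul_of_nonneg_left hlo' (exp_pos _).le)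
  rw [← exp_add, e _ (by ring)] at h1 h2
  refine (measureReal_mono (s₂ := {ω | m + m * x ≤ aggDeg n T A ω i} ∪
    {ω | aggDeg n T A ω i ≤ m - m * x}) fun ω hω => ?_).trans
    ((measureReal_union_le _ _).trans (by linarith))
  rcases le_abs.1 (show m * x ≤ |aggDeg n T A ω i - m| from hω) with h' | h'
  · left; simp only [Set.mem_ofPred_eq]; linarith
  · right; simp only [Set.mem_ofPred_eq]; linarith

end IsLazyIER

lemma abs_sqrt_sub_one_le {r : ℝ} (hr : 0 ≤ r) : |√r - 1| ≤ |r - 1| := by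
  have h : r - 1 = (√r - 1) * (√r + 1) := by nlinarith [sq_sqrt hr]
  rw [h, abs_mul]
  refine le_mul_of_one_le_right (abs_nonneg _) (le_abs.2 (Or.inl ?_))
  linarith [sqrt_nonneg r]

/-- **Lemma (concentration of the square-root degree ratio).** There is a
constant `κ = κ(α)` such that if `T·d_min > C(α)(log n)^3` for a sufficiently
large constant `C(α)` and `n` is sufficiently large, then for every `i` and
every `δ ∈ (n^{-c}, 1/2)`,
`P(|√(ℓ_i/ℓ̄_i) - 1| > κ √(log(n/δ)/(T d_min))) ≤ δ/(2n)`. -/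
theorem lazyIER_sqrt_degree_ratio_concentration :
    ∀ α : ℝ, α ∈ Set.Ioo (0 : ℝ) 1 → ∀ c : ℝ, 0 < c →
      ∃ (κ C : ℝ) (n₀ : ℕ),
        ∀ (n T : ℕ) (P : Matrix (Fin n) (Fin n) ℝ)
          (Ω : Type) (_ : MeasurableSpace Ω) (μ : Measure Ω)
          (A : ℕ → Ω → Fin n → Fin n → Bool),
          IsLazyIER μ n T P α A →
          n₀ ≤ n →
          (T : ℝ) * dMin P > C * (Real.log n) ^ 3 →
          ∀ (i : Fin n) (δ : ℝ), (n : ℝ) ^ (-c) < δ → δ < 1 / 2 →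
            (μ {ω | |Real.sqrt (aggDeg n T A ω i / meanDeg μ n T A i) - 1| >
                κ * Real.sqrt (Real.log ((n : ℝ) / δ) / ((T : ℝ) * dMin P))}).toReal
              ≤ δ / (2 * n) := by
  intro α hα c hc
  have hα' : 0 < 1 - α := sub_pos.2 hα.2
  refine ⟨√(32 / (1 - α) ^ 2), 8 * (1 + c) / (1 - α) ^ 2, 3, ?_⟩
  intro n T P Ω _ μ A h hn hTd i δ hδ hδ2
  have := h.prob
  have hn3 : (3 : ℝ) ≤ n := by exact_mod_cast hn
  have hn0 : (0 : ℝ) < n := by linarith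
  have hδ0 : 0 < δ := (rpow_pos_of_pos hn0 _).trans hδ
  have hlog : 1 ≤ log n := by
    rw [le_log_iff_exp_le hn0]
    linarith [exp_one_lt_d9]
  set L := log (n / δ) with hL
  have hL0 : 0 ≤ L := log_nonneg (by rw [le_div_iff₀ hδ0]; linarith)
  have hL1 : L ≤ (1 + c) * log n := by
    have := log_lt_log (rpow_pos_of_pos hn0 _) hδ
    rw [log_rpow hn0] at this
    rw [hL, log_div hn0.ne' hδ0.ne']
    linarith
  set D := (T : ℝ) * dMin P with hD
  have hCD : 8 * (1 + c) / (1 - α) ^ 2 * log n ≤ D := by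
    refine le_trans ?_ hTd.le
    refine mul_le_mul_of_nonneg_left ?_ (by positivity)
    exact le_self_pow₀ hlog (by norm_num)
  have hD0 : 0 < D := lt_of_lt_of_le (by positivity) hCD
  set x := √(32 / (1 - α) ^ 2) * √(L / D) with hx
  have hx0 : 0 ≤ x := by positivity
  have hxsq : x ^ 2 = 32 / (1 - α) ^ 2 * (L / D) := by
    rw [hx, mul_pow, sq_sqrt (by positivity), sq_sqrt (by positivity)]
  have hx2 : x ≤ 2 := by
    refine le_of_sq_le_sq ?_ (by norm_num)
    rw [hxsq, ← mul_div_assoc, div_le_iff₀ hD0]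
    have : 32 / (1 - α) ^ 2 * L ≤ 32 / (1 - α) ^ 2 * ((1 + c) * log n) :=
      mul_le_mul_of_nonneg_left hL1 (by positivity)
    refine this.trans ?_
    calc _ = 4 * (8 * (1 + c) / (1 - α) ^ 2 * log n) := by ring
      _ ≤ _ := by linarith
  set m := meanDeg μ n T A i with hm
  have hm' : m = T * ∑ j, P i j := h.meanDeg_eq i
  have hDm : D ≤ m := by
    rw [hm', hD]
    exact mul_le_mul_of_nonneg_left (ciInf_le (Set.finite_range _).bddBelow i) (by positivity)
  have hm0 : 0 < m := hD0.trans_le hDm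
  have hsub : {ω | |√(aggDeg n T A ω i / m) - 1| > x} ⊆
      {ω | m * x ≤ |aggDeg n T A ω i - m|} := by
    intro ω hω
    have hdeg : 0 ≤ aggDeg n T A ω i := Finset.sum_nonneg fun j _ =>
      Finset.sum_nonneg fun t _ => by split_ifs <;> norm_num
    have h1 := (lt_of_lt_of_le (show x < _ from hω)
      (abs_sqrt_sub_one_le (div_nonneg hdeg hm0.le))).le
    have h2 : aggDeg n T A ω i - m = m * (aggDeg n T A ω i / m - 1) := by field_simp
    rw [Set.mem_ofPred_eq, h2, abs_mul, abs_of_pos hm0]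
    exact mul_le_mul_of_nonneg_left h1 hm0.le
  have hexp : 2 * L ≤ m * x ^ 2 * (1 - α) ^ 2 / 16 := by
    have : D * x ^ 2 * (1 - α) ^ 2 / 16 = 2 * L := by rw [hxsq]; field_simp; ring
    rw [← this]
    gcongr
  calc μ.real {ω | |√(aggDeg n T A ω i / m) - 1| > x}
      ≤ μ.real {ω | m * x ≤ |aggDeg n T A ω i - m|} := measureReal_mono hsub
    _ ≤ 2 * exp (-(m * x ^ 2 * (1 - α) ^ 2 / 16)) :=
        h.measureReal_aggDeg_deviation_le i hm' hx0 hx2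
    _ ≤ 2 * exp (-(2 * L)) := by gcongr
    _ = 2 * (δ / n) ^ 2 := by
        rw [show -(2 * L) = -L + -L by ring, exp_add, exp_neg, hL, exp_log (by positivity),
          inv_div, sq]
    _ ≤ δ / (2 * n) := by
        have : δ / n ≤ 1 / 4 := by rw [div_le_iff₀ hn0]; linarith
        have hpos : 0 ≤ δ / n := by positivity
        calc 2 * (δ / n) ^ 2 ≤ δ / n / 2 := by nlinarith
          _ = _ := by field_simp
end
end

section
/- Let A be a symmetric n×n matrix with nonnegative entries and positive row sums ℓ_1,…,ℓ_n, let ℓ̄_1,…,ℓ̄_n be positive reals, let D (resp. D̄) be the diagonal matrix with i-th entry ℓ_i^{−1/2} (resp. ℓ̄_i^{−1/2}), and set 𝓛 = I − D A D and 𝓜 = I − D̄ A D̄. If ‖I − 𝓛‖ ≤ 1, then ‖𝓛 − 𝓜‖ ≤ ‖D̄ D^{−1} − I‖ ( ‖D̄ D^{−1} − I‖ + 2 ), where ‖·‖ denotes the matrix operator (spectral) norm. -/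
open Matrix

noncomputable section

open scoped Matrix.Norms.L2Operator in
theorem opNorm_eq_l2_opNorm {k l : ℕ} (M : Matrix (Fin k) (Fin l) ℝ) : opNorm M = ‖M‖ :=
  rfl

theorem opNorm_nonneg {k l : ℕ} (M : Matrix (Fin k) (Fin l) ℝ) : 0 ≤ opNorm M :=
  norm_nonneg _

open scoped Matrix.Norms.L2Operator in
theorem opNorm_add_le {k l : ℕ} (M N : Matrix (Fin k) (Fin l) ℝ) :
    opNorm (M + N) ≤ opNorm M + opNorm N := by
  simpa only [opNorm_eq_l2_opNorm] using norm_add_le M N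

theorem opNorm_mul_le {k l m : ℕ} (M : Matrix (Fin k) (Fin l) ℝ) (N : Matrix (Fin l) (Fin m) ℝ) :
    opNorm (M * N) ≤ opNorm M * opNorm N := by
  simpa only [opNorm_eq_l2_opNorm] using Matrix.l2_opNorm_mul M N

theorem opNorm_conj_sub_le {n : ℕ} (K F : Matrix (Fin n) (Fin n) ℝ) (hK : opNorm K ≤ 1) :
    opNorm (F * K * F - K) ≤ opNorm (F - 1) * (opNorm (F - 1) + 2) := by
  have hdecomp : F * K * F - K = (F - 1) * K * (F - 1) + (F - 1) * K + K * (F - 1) := by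
    noncomm_ring
  rw [hdecomp]
  set E := F - 1
  have hE := opNorm_nonneg E
  have hEK : opNorm (E * K) ≤ opNorm E :=
    (opNorm_mul_le E K).trans (mul_le_of_le_one_right hE hK)
  have hKE : opNorm (K * E) ≤ opNorm E :=
    (opNorm_mul_le K E).trans (mul_le_of_le_one_left hE hK)
  have hEKE : opNorm (E * K * E) ≤ opNorm E * opNorm E :=
    (opNorm_mul_le (E * K) E).trans (mul_le_mul_of_nonneg_right hEK hE)
  linarith [opNorm_add_le (E * K * E + E * K) (K * E), opNorm_add_le (E * K * E) (E * K)]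

/-- **Lemma (Laplacian perturbation bound).** Let `A` be symmetric with
nonnegative entries and positive row sums `ℓ_i`, let `ℓ̄_i > 0`, let `D` (resp.
`D̄`) be diagonal with entries `ℓ_i^{-1/2}` (resp. `ℓ̄_i^{-1/2}`), and set
`𝓛 = I - D A D`, `𝓜 = I - D̄ A D̄`. If `‖I - 𝓛‖ ≤ 1`, then
`‖𝓛 - 𝓜‖ ≤ ‖D̄ D⁻¹ - I‖ (‖D̄ D⁻¹ - I‖ + 2)`. -/
theorem laplacian_perturbation_bound
    (n : ℕ) (A : Matrix (Fin n) (Fin n) ℝ)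
    (hsymm : ∀ i j, A i j = A j i) (hnonneg : ∀ i j, 0 ≤ A i j)
    (ℓ ℓbar : Fin n → ℝ)
    (hℓ : ∀ i, ℓ i = ∑ j, A i j)
    (hℓpos : ∀ i, 0 < ℓ i) (hℓbarpos : ∀ i, 0 < ℓbar i) :
    ∀ (D Dbar L M : Matrix (Fin n) (Fin n) ℝ),
      D = Matrix.diagonal (fun i => (Real.sqrt (ℓ i))⁻¹) →
      Dbar = Matrix.diagonal (fun i => (Real.sqrt (ℓbar i))⁻¹) →
      L = 1 - D * A * D →
      M = 1 - Dbar * A * Dbar →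
      opNorm (1 - L) ≤ 1 →
      opNorm (L - M) ≤ opNorm (Dbar * D⁻¹ - 1) * (opNorm (Dbar * D⁻¹ - 1) + 2) := by
  intro D Dbar L M hD hDbar hL hM hnorm
  have hdet : IsUnit D.det := by
    rw [hD, Matrix.det_diagonal, isUnit_iff_ne_zero]
    exact Finset.prod_ne_zero_iff.mpr fun i _ => inv_ne_zero (Real.sqrt_pos.mpr (hℓpos i)).ne'
  have hcomm : Dbar * D = D * Dbar := by
    rw [hD, hDbar]
    exact Matrix.commute_diagonal _ _
  have hleft : Dbar * D⁻¹ * D = Dbar := Matrix.nonsing_inv_mul_cancel_right _ _ hdet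
  have hright : D * (Dbar * D⁻¹) = Dbar := by
    rw [← mul_assoc, ← hcomm, Matrix.mul_nonsing_inv_cancel_right _ _ hdet]
  have hdiff : L - M = Dbar * D⁻¹ * (1 - L) * (Dbar * D⁻¹) - (1 - L) := by
    have hconj : Dbar * D⁻¹ * (D * A * D) * (Dbar * D⁻¹) = Dbar * A * Dbar := by
      calc Dbar * D⁻¹ * (D * A * D) * (Dbar * D⁻¹)
          = Dbar * D⁻¹ * D * A * (D * (Dbar * D⁻¹)) := by simp only [mul_assoc]
        _ = Dbar * A * Dbar := by rw [hleft, hright]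
    rw [hL, hM, sub_sub_cancel, hconj]
    abel
  rw [hdiff]
  exact opNorm_conj_sub_le _ _ hnorm
end
end

section
/- Fix α ∈ (0,1) and define ψ(λ) = (1 − α)²/(e^{−λ} − α) − (1 − α) for λ < log(1/α). Then ψ(0) = 0, ψ is convex on its domain, ψ(λ) ≤ λ ψ'(λ) for all λ ∈ (0, log(1/α)), and for every λ with 0 < λ < (1 − α)/2 one has ψ'(λ) ≤ (1 + 6λ/(1 − α)), hence ψ(λ) ≤ λ (1 + 6λ/(1 − α)). -/
open Real

noncomputable section

/-- `ψ(λ) = (1-α)²/(e^{-λ} - α) - (1-α)`. -/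
def psiFn (α lam : ℝ) : ℝ := (1 - α) ^ 2 / (Real.exp (-lam) - α) - (1 - α)

/-- `ψ'(λ) = (1-α)² e^{-λ} / (e^{-λ} - α)²`. -/
def psiFn' (α lam : ℝ) : ℝ :=
  (1 - α) ^ 2 * Real.exp (-lam) / (Real.exp (-lam) - α) ^ 2

theorem lt_exp_neg_of_lt_log_one_div {α lam : ℝ} (hα : 0 < α) (h : lam < Real.log (1 / α)) :
    α < Real.exp (-lam) := by
  rw [one_div, Real.log_inv] at h
  exact (Real.log_lt_iff_lt_exp hα).1 (by linarith)

theorem hasDerivAt_psiFn {α lam : ℝ} (h : α < Real.exp (-lam)) :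
    HasDerivAt (psiFn α) (psiFn' α lam) lam := by
  have h0 : Real.exp (-lam) - α ≠ 0 := (sub_pos.2 h).ne'
  have h1 : HasDerivAt (fun x : ℝ => Real.exp (-x) - α) (-Real.exp (-lam)) lam := by
    simpa using ((hasDerivAt_neg lam).exp).sub_const α
  have h2 := ((hasDerivAt_const lam ((1 - α) ^ 2)).div h1 h0).sub_const (1 - α)
  exact h2.congr_deriv (by simp [psiFn'])

theorem psiFn'_le_psiFn' {α x y : ℝ} (hα : 0 < α) (hxy : x ≤ y) (hy : α < Real.exp (-y)) :
    psiFn' α x ≤ psiFn' α y := by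
  have hexp : Real.exp (-y) ≤ Real.exp (-x) := Real.exp_le_exp.2 (neg_le_neg hxy)
  unfold psiFn'
  generalize Real.exp (-y) = v at *
  generalize Real.exp (-x) = u at *
  have hu : 0 < u - α := by linarith
  have hv : 0 < v - α := by linarith
  rw [mul_div_assoc, mul_div_assoc]
  refine mul_le_mul_of_nonneg_left ?_ (sq_nonneg _)
  rw [div_le_div_iff₀ (by positivity) (by positivity)]
  have huv : 0 ≤ u * v - α ^ 2 := by nlinarith [mul_pos hu hv]
  nlinarith [mul_nonneg (sub_nonneg.2 hexp) huv]

theorem convexOn_psiFn {α : ℝ} (hα : 0 < α) :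
    ConvexOn ℝ (Set.Iio (Real.log (1 / α))) (psiFn α) := by
  have hd : ∀ x ∈ Set.Iio (Real.log (1 / α)), HasDerivAt (psiFn α) (psiFn' α x) x :=
    fun x hx => hasDerivAt_psiFn (lt_exp_neg_of_lt_log_one_div hα hx)
  refine MonotoneOn.convexOn_of_deriv (convex_Iio _)
    (fun x hx => (hd x hx).continuousAt.continuousWithinAt) ?_ ?_ <;> rw [interior_Iio]
  · exact fun x hx => (hd x hx).differentiableAt.differentiableWithinAt
  · intro x hx y hy hxy
    rw [(hd x hx).deriv, (hd y hy).deriv]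
    exact psiFn'_le_psiFn' hα hxy (lt_exp_neg_of_lt_log_one_div hα hy)

theorem psiFn_zero {α : ℝ} (hα : α < 1) : psiFn α 0 = 0 := by
  have : 1 - α ≠ 0 := (sub_pos.2 hα).ne'
  simp only [psiFn, neg_zero, Real.exp_zero]
  field_simp
  ring

theorem psiFn_le_mul_psiFn' {α lam : ℝ} (hα : α ∈ Set.Ioo (0 : ℝ) 1) (h0 : 0 < lam)
    (h : lam < Real.log (1 / α)) : psiFn α lam ≤ lam * psiFn' α lam := by
  have hs := (convexOn_psiFn hα.1).slope_le_of_hasDerivAt (h0.trans h) h h0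
    (hasDerivAt_psiFn (lt_exp_neg_of_lt_log_one_div hα.1 h))
  rw [slope_def_field, psiFn_zero hα.2, sub_zero, sub_zero, div_le_iff₀ h0] at hs
  linarith

theorem psiFn'_le_one_add {α lam : ℝ} (h0 : 0 < lam)
    (h : lam < (1 - α) / 2) : psiFn' α lam ≤ 1 + 6 * lam / (1 - α) := by
  have hb : 0 < 1 - α := by linarith
  have hl : 0 < 1 - lam - α := by linarith
  have he : 1 - lam ≤ Real.exp (-lam) := Real.one_sub_le_exp_neg lam
  calc psiFn' α lam ≤ (1 - α) ^ 2 * 1 / (1 - lam - α) ^ 2 := by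
        unfold psiFn'
        gcongr
        exact Real.exp_le_one_iff.2 (by linarith)
    _ ≤ 1 + 6 * lam / (1 - α) := by
        obtain ⟨b, rfl⟩ : ∃ b, α = 1 - b := ⟨1 - α, by ring⟩
        simp only [sub_sub_cancel] at hb h ⊢
        rw [show 1 + 6 * lam / b = (b + 6 * lam) / b by field_simp,
          div_le_div_iff₀ (by positivity) hb]
        have hp : 0 ≤ lam * (b - 2 * lam) * (4 * b - 3 * lam) :=
          mul_nonneg (mul_nonneg h0.le (by linarith)) (by linarith)
        linear_combination hp

theorem lt_log_one_div_of_lt {α lam : ℝ} (hα : α ∈ Set.Ioo (0 : ℝ) 1)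
    (h : lam < (1 - α) / 2) : lam < Real.log (1 / α) := by
  rw [one_div, Real.log_inv]
  linarith [Real.log_le_sub_one_of_pos hα.1, hα.2]

/-- **Lemma (properties of `ψ`).** For `α ∈ (0,1)` and
`ψ(λ) = (1-α)²/(e^{-λ} - α) - (1-α)` on `λ < log(1/α)`: `ψ(0) = 0`, `ψ` is
convex on its domain, `ψ'` is its derivative there, `ψ(λ) ≤ λ ψ'(λ)` for
`0 < λ < log(1/α)`, and for `0 < λ < (1-α)/2` one has
`ψ'(λ) ≤ 1 + 6λ/(1-α)`, hence `ψ(λ) ≤ λ(1 + 6λ/(1-α))`. -/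
theorem psi_properties (α : ℝ) (hα : α ∈ Set.Ioo (0 : ℝ) 1) :
    psiFn α 0 = 0 ∧
    ConvexOn ℝ (Set.Iio (Real.log (1 / α))) (psiFn α) ∧
    (∀ lam : ℝ, lam < Real.log (1 / α) → HasDerivAt (psiFn α) (psiFn' α lam) lam) ∧
    (∀ lam : ℝ, 0 < lam → lam < Real.log (1 / α) → psiFn α lam ≤ lam * psiFn' α lam) ∧
    (∀ lam : ℝ, 0 < lam → lam < (1 - α) / 2 →
      psiFn' α lam ≤ 1 + 6 * lam / (1 - α) ∧
      psiFn α lam ≤ lam * (1 + 6 * lam / (1 - α))) := by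
  refine ⟨psiFn_zero hα.2, convexOn_psiFn hα.1,
    fun lam h => hasDerivAt_psiFn (lt_exp_neg_of_lt_log_one_div hα.1 h),
    fun lam h0 h => psiFn_le_mul_psiFn' hα h0 h, fun lam h0 h => ?_⟩
  have hle := psiFn'_le_one_add h0 h
  exact ⟨hle, (psiFn_le_mul_psiFn' hα h0 (lt_log_one_div_of_lt hα h)).trans
    (mul_le_mul_of_nonneg_left hle h0.le)⟩
end
end
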